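/- arXiv:1005.4258 — 2 statements merged into one kernel-verified Lean document; each statement's English description precedes it below -/
import Mathlib

section
/- For all natural numbers p, q with p ≥ n·z and q ≥ n·z, the number of words w over Γ with ||w|| = p + q, |w|_{b_i} = n_i for each i, and having a prefix of weight exactly p, equals ∑_{k=0}^{n} C(p − k·z, k) · C(q − (n − k)·z, n − k). -/
/-- The alphabet `Γ = {a, b₁, …, bₘ}`: `none` encodes the letter `a`, and
`some i` encodes the letter `bᵢ`. -/
abbrev Letter (m : ℕ) := Option (Fin m)

/-- The grading of letters: `‖a‖ = 1` and `‖bᵢ‖ = zᵢ + 1`. -/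
def letterWt {m : ℕ} (z : Fin m → ℕ) : Letter m → ℕ
  | none => 1
  | some i => z i + 1

/-- The weight `‖w‖` of a word: the sum of the weights of its letters. -/
def wordWt {m : ℕ} (z : Fin m → ℕ) (w : List (Letter m)) : ℕ :=
  (w.map (letterWt z)).sum

/-- The multinomial coefficient `C(x, k) = x(x-1)⋯(x-|k|+1)/k!` for `x : ℝ`
and a multi-index `k : Fin m → ℕ`. -/
noncomputable def mchoose {m : ℕ} (x : ℝ) (k : Fin m → ℕ) : ℝ :=
  (∏ j ∈ Finset.range (∑ i, k i), (x - (j : ℝ))) / ∏ i, (Nat.factorial (k i) : ℝ)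

/-- The dot product `k·z = k₁z₁ + ⋯ + kₘzₘ` of multi-indices. -/
def mdot {m : ℕ} (k z : Fin m → ℕ) : ℕ := ∑ i, k i * z i

/-- A nonempty word is its first letter followed by a word, so words with prescribed letter counts
`c ≠ 0` are classified by their first letter. -/
def wordsConsEquiv {α : Type*} [BEq α] (c : α → ℕ) (hc : c ≠ 0) :
    {w : List α // ∀ b, w.count b = c b} ≃
      Σ a : α, {w : List α // ∀ b, (a :: w).count b = c b} where
  toFun
    | ⟨[], h⟩ => (hc (funext fun b => (h b).symm)).elim
    | ⟨a :: w, h⟩ => ⟨a, w, h⟩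
  invFun x := ⟨x.1 :: x.2.1, x.2.2⟩
  left_inv
    | ⟨[], h⟩ => (hc (funext fun b => (h b).symm)).elim
    | ⟨_ :: _, _⟩ => rfl
  right_inv _ := rfl

lemma sum_count_eq_length {α : Type*} [Fintype α] [BEq α] [LawfulBEq α] (w : List α) :
    ∑ a, w.count a = w.length := by
  classical
  induction w with
  | nil => simp
  | cons a w ih => simp [List.count_cons, Finset.sum_add_distrib, ih]

lemma finite_words_count {α : Type*} [Fintype α] [BEq α] [LawfulBEq α] (P : List α → Prop)
    (c : α → ℕ) (hP : ∀ w, P w → ∀ b, w.count b = c b) : Finite {w : List α // P w} :=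
  Set.Finite.to_subtype (s := {w | P w}) <|
    (List.finite_length_eq α (∑ a, c a)).subset fun w hw => by
      rw [Set.mem_ofPred_eq, ← sum_count_eq_length]
      exact Finset.sum_congr rfl fun b _ => hP w hw b

/-- The number of words with letter counts `c` is a multinomial coefficient. -/
lemma prod_factorial_mul_card_words {α : Type*} [Fintype α] [BEq α] [LawfulBEq α]
    (c : α → ℕ) :
    (∏ a, (c a).factorial) * Nat.card {w : List α // ∀ b, w.count b = c b} =
      (∑ a, c a).factorial := by
  classical
  induction hs : ∑ a, c a generalizing c with
  | zero =>
    obtain rfl : c = 0 := by ext a; simpa using (Finset.sum_eq_zero_iff.1 hs) a (by simp)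
    have : Nat.card {w : List α // ∀ b, w.count b = (0 : α → ℕ) b} = 1 := by
      refine Nat.card_eq_one_iff_exists.2 ⟨⟨[], by simp⟩, fun w => Subtype.ext ?_⟩
      exact List.eq_nil_iff_forall_not_mem.2 fun a => List.count_eq_zero.1 (w.2 a)
    rw [this]
    simp
  | succ s ih =>
    have hc : c ≠ 0 := by rintro rfl; simp at hs
    have (a : α) : Finite {w : List α // ∀ b, (a :: w).count b = c b} :=
      finite_words_count _ (fun b => c b - if a == b then 1 else 0) fun w hw b => by
        rw [← hw b, List.count_cons]; simp
    have fiber (a : α) : (∏ b, (c b).factorial) *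
        Nat.card {w : List α // ∀ b, (a :: w).count b = c b} = c a * s.factorial := by
      obtain h0 | hpos := Nat.eq_zero_or_pos (c a)
      · have : IsEmpty {w : List α // ∀ b, (a :: w).count b = c b} :=
          ⟨fun w => by simpa [h0] using w.2 a⟩
        simp [h0]
      · obtain ⟨d, hd⟩ : ∃ d : α → ℕ, c = d + Pi.single a 1 :=
          ⟨c - Pi.single a 1, by
            ext b; by_cases h : b = a
            · subst h; simp; omega
            · simp [h]⟩
        subst hd
        have hds : ∑ b, d b = s := by simpa [Finset.sum_add_distrib] using hs
        have hset (w : List α) : (∀ b, (a :: w).count b = (d + Pi.single a 1 : α → ℕ) b) ↔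
            ∀ b, w.count b = d b := by
          refine forall_congr' fun b => ?_
          by_cases h : b = a
          · subst h; simp
          · simp [h, Ne.symm h]
        have hprod : ∏ b, ((d + Pi.single a 1 : α → ℕ) b).factorial =
            (d a + 1) * ∏ b, (d b).factorial := by
          rw [← Finset.mul_prod_erase _ _ (Finset.mem_univ a),
            ← Finset.mul_prod_erase _ (fun b => (d b).factorial) (Finset.mem_univ a), ← mul_assoc]
          congr 1
          · simp [Nat.factorial_succ]
          · refine Finset.prod_congr rfl fun b hb => ?_
            simp [Finset.ne_of_mem_erase hb]
        rw [hprod, Nat.card_congr (Equiv.subtypeEquivRight hset), mul_assoc, ih d hds]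
        simp
    rw [Nat.card_congr (wordsConsEquiv c hc), Nat.card_sigma, Finset.mul_sum,
      Finset.sum_congr rfl fun a _ => fiber a, ← Finset.sum_mul, hs, Nat.factorial_succ]

section Words

variable {m : ℕ} {z : Fin m → ℕ}

lemma wordWt_append (u v : List (Letter m)) : wordWt z (u ++ v) = wordWt z u + wordWt z v := by
  simp [wordWt]

lemma wordWt_eq (w : List (Letter m)) :
    wordWt z w = w.count none + ∑ i, w.count (some i) + mdot (fun i => w.count (some i)) z := by
  induction w with
  | nil => simp [wordWt, mdot]
  | cons a w ih =>
    rw [← List.singleton_append, wordWt_append, ih]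
    cases a with
    | none => simp [wordWt, letterWt, mdot]; ring
    | some j =>
      simp [wordWt, letterWt, mdot, List.count_cons, add_mul, Finset.sum_add_distrib]
      ring

/-- The weight of a word with prescribed numbers of letters `bᵢ`. -/
lemma wordWt_eq_of_count {w : List (Letter m)} {k : Fin m → ℕ}
    (hk : ∀ i, w.count (some i) = k i) :
    wordWt z w = w.count none + ∑ i, k i + mdot k z := by
  obtain rfl : (fun i => w.count (some i)) = k := funext hk
  exact wordWt_eq w

lemma eq_nil_of_wordWt_eq_zero {w : List (Letter m)} (h : wordWt z w = 0) : w = [] := by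
  cases w with
  | nil => rfl
  | cons a w => cases a <;> simp [wordWt, letterWt] at h

/-- Prefixes of a word are determined by their weight. -/
lemma eq_of_append_eq_append {u v u' v' : List (Letter m)} (h : u ++ v = u' ++ v')
    (hu : wordWt z u = wordWt z u') : u = u' ∧ v = v' := by
  obtain ⟨t, rfl, rfl⟩ | ⟨t, rfl, rfl⟩ := List.append_eq_append_iff.1 h
  all_goals
    rw [wordWt_append] at hu
    obtain rfl : t = [] := eq_nil_of_wordWt_eq_zero (z := z) (by omega)
    simp

lemma mchoose_natCast (N : ℕ) (k : Fin m → ℕ) :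
    mchoose (N : ℝ) k = (N.descFactorial (∑ i, k i) : ℝ) / ∏ i, ((k i).factorial : ℝ) := by
  rw [mchoose]
  congr 1
  generalize ∑ i, k i = K
  induction K with
  | zero => simp
  | succ K ih =>
    rw [Finset.prod_range_succ, ih, Nat.descFactorial_succ]
    obtain h | h := le_or_gt K N
    · push_cast [Nat.cast_sub h]; ring
    · simp [Nat.descFactorial_eq_zero_iff_lt.2 h]

/-- The words of weight `p` in which each `bᵢ` occurs `kᵢ` times. -/
abbrev WeightedWords (z : Fin m → ℕ) (p : ℕ) (k : Fin m → ℕ) :=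
  {w : List (Letter m) // wordWt z w = p ∧ ∀ i, w.count (some i) = k i}

instance (p : ℕ) (k : Fin m → ℕ) : Finite (WeightedWords z p k) := by
  refine finite_words_count _ (fun a => a.elim (p - (∑ i, k i + mdot k z)) k) fun w hw b => ?_
  obtain ⟨h, hk⟩ := hw
  rw [wordWt_eq_of_count hk] at h
  cases b with
  | none => simp only [Option.elim]; omega
  | some i => exact hk i

lemma card_weightedWords (p : ℕ) (k : Fin m → ℕ) (hp : mdot k z ≤ p) :
    (Nat.card (WeightedWords z p k) : ℝ) = mchoose ((p : ℝ) - (mdot k z : ℕ)) k := by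
  rw [← Nat.cast_sub hp, mchoose_natCast, eq_div_iff (by positivity)]
  norm_cast
  obtain h | h := lt_or_ge (p - mdot k z) (∑ i, k i)
  · have : IsEmpty (WeightedWords z p k) := ⟨fun ⟨w, hw, hk⟩ => by
      rw [wordWt_eq_of_count hk] at hw
      omega⟩
    simp [Nat.descFactorial_eq_zero_iff_lt.2 h]
  · set r := p - mdot k z - ∑ i, k i with hr
    have key := prod_factorial_mul_card_words (fun a : Letter m => a.elim r k)
    have hset (w : List (Letter m)) : (∀ b : Letter m, w.count b = b.elim r k) ↔
        wordWt z w = p ∧ ∀ i, w.count (some i) = k i := by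
      rw [Option.forall]
      refine and_congr_left fun hk => ?_
      rw [wordWt_eq_of_count (k := k) hk]
      simp only [Option.elim]
      omega
    rw [Nat.card_congr (Equiv.subtypeEquivRight hset), Fintype.prod_option,
      Fintype.sum_option] at key
    simp only [Option.elim] at key
    have hf := Nat.factorial_mul_descFactorial h
    rw [← hr] at hf
    rw [show r + ∑ i, k i = p - mdot k z by omega, ← hf, mul_assoc] at key
    rw [mul_comm]
    exact Nat.eq_of_mul_eq_mul_left (Nat.factorial_pos r) key

/-- Cutting a word after its prefix of weight `p`. -/
noncomputable def prefixWordsEquiv (z n : Fin m → ℕ) (p q : ℕ) :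
    (Σ k : Finset.Iic n, WeightedWords z p k × WeightedWords z q (n - k)) ≃
      {w : List (Letter m) // wordWt z w = p + q ∧ (∀ i, w.count (some i) = n i) ∧
        ∃ u : List (Letter m), u <+: w ∧ wordWt z u = p} :=
  Equiv.ofBijective
    (fun x => ⟨x.2.1.1 ++ x.2.2.1, by
      obtain ⟨⟨k, hk⟩, ⟨u, hu, hku⟩, ⟨v, hv, hkv⟩⟩ := x
      rw [Finset.mem_Iic] at hk
      refine ⟨(wordWt_append u v).trans (by rw [hu, hv]), fun i => ?_, u, List.prefix_append _ _, hu⟩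
      rw [List.count_append, hku, hkv, Pi.sub_apply, Nat.add_sub_cancel' (hk i)]⟩) <| by
    constructor
    · rintro ⟨⟨k, hk⟩, ⟨u, hu, hku⟩, ⟨v, hv, hkv⟩⟩ ⟨⟨k', hk'⟩, ⟨u', hu', hku'⟩, ⟨v', hv', hkv'⟩⟩ h
      obtain ⟨rfl, rfl⟩ := eq_of_append_eq_append (z := z) (congrArg Subtype.val h)
        (hu.trans hu'.symm)
      obtain rfl : k = k' := funext fun i => (hku i).symm.trans (hku' i)
      rfl
    · rintro ⟨_, hw, hc, u, ⟨v, rfl⟩, hu⟩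
      simp only [List.count_append] at hc
      refine ⟨⟨⟨fun i => u.count (some i),
          Finset.mem_Iic.2 fun i => (Nat.le_add_right _ _).trans_eq (hc i)⟩,
        ⟨u, hu, fun _ => rfl⟩, ⟨v, ?_, fun i => ?_⟩⟩, rfl⟩
      · rw [wordWt_append, hu] at hw
        exact Nat.add_left_cancel hw
      · rw [Pi.sub_apply, ← hc i, Nat.add_sub_cancel_left]

lemma mdot_mono {k n : Fin m → ℕ} (h : k ≤ n) : mdot k z ≤ mdot n z :=
  Finset.sum_le_sum fun i _ => Nat.mul_le_mul_right _ (h i)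

end Words

/-- **Equation (2.3)**: for `p, q ≥ n·z`, the number of words `w` over `Γ` with
`‖w‖ = p + q`, `|w|_{bᵢ} = nᵢ` for each `i`, and having a prefix of weight exactly `p`,
equals `∑_{k=0}^{n} C(p − k·z, k) · C(q − (n − k)·z, n − k)`. -/
theorem card_words_with_prefix (m : ℕ) (hm : 0 < m) (z n : Fin m → ℕ)
    (p q : ℕ) (hp : mdot n z ≤ p) (hq : mdot n z ≤ q) :
    (Nat.card {w : List (Letter m) //
        wordWt z w = p + q ∧ (∀ i, w.count (some i) = n i) ∧
        ∃ u : List (Letter m), u <+: w ∧ wordWt z u = p} : ℝ) =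
      ∑ k ∈ Finset.Iic n,
        mchoose ((p : ℝ) - (mdot k z : ℕ)) k *
          mchoose ((q : ℝ) - (mdot (n - k) z : ℕ)) (n - k) := by
  rw [← Nat.card_congr (prefixWordsEquiv z n p q), Nat.card_sigma, Nat.cast_sum,
    ← Finset.sum_coe_sort (Finset.Iic n)]
  refine Finset.sum_congr rfl fun k _ => ?_
  have hk : n - k.1 ≤ n := fun i => Nat.sub_le _ _
  rw [Nat.card_prod, Nat.cast_mul,
    card_weightedWords p _ ((mdot_mono (Finset.mem_Iic.1 k.2)).trans hp),
    card_weightedWords q _ ((mdot_mono hk).trans hq)]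
end

section
/- For every positive integer m, multi-indices n, z ∈ ℕ^m with z_i ≥ 1 for all i, and natural numbers p, q with p ≥ n·z and q ≥ 1, one has ∑_{k=0}^{n} [ C(p − k·z, k) · C(q + k·z, n − k) + ∑_{i=1}^{m} ∑_{j=1}^{z_i} C(p − k·z + j − 1, k − e_i) · C(q + k·z − j, n − k) ] = C(p + q, n), where e_i denotes the i-th standard unit multi-index and C(x, k − e_i) = 0 if k_i = 0. -/
/-- The multinomial coefficient `C(x, k − eᵢ)`, with the convention that it is `0`
when `kᵢ = 0` (i.e. when `k − eᵢ` has a negative component). -/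
noncomputable def mchooseSub {m : ℕ} (x : ℝ) (k : Fin m → ℕ) (i : Fin m) : ℝ :=
  if k i = 0 then 0 else mchoose x (k - Pi.single i 1)

open Finset

section KeyIdentity

variable {m : ℕ}

lemma sum_sub_single_add_one {k : Fin m → ℕ} {i : Fin m} (h : k i ≠ 0) :
    ∑ l, (k - Pi.single i 1 : Fin m → ℕ) l + 1 = ∑ l, k l := by
  have e : k = (k - Pi.single i 1) + Pi.single i 1 := by
    funext l
    by_cases hl : l = i
    · subst hl; simp; omega
    · simp [hl]
  conv_rhs => rw [e]
  simp only [Pi.add_apply, sum_add_distrib]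
  simp

lemma mdot_sub_single_add {k : Fin m → ℕ} (z : Fin m → ℕ) {i : Fin m} (h : k i ≠ 0) :
    mdot (k - Pi.single i 1) z + z i = mdot k z := by
  unfold mdot
  rw [← add_sum_erase _ _ (mem_univ i), ← add_sum_erase univ (fun l => k l * z l) (mem_univ i),
    sum_congr rfl (g := fun l => k l * z l)
      (fun l hl => by simp [ne_of_mem_erase hl])]
  obtain ⟨a, ha⟩ := Nat.exists_eq_succ_of_ne_zero h
  simp [ha]
  ring

lemma prod_factorial_sub_single {k : Fin m → ℕ} {i : Fin m} (h : k i ≠ 0) :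
    (k i : ℝ) * ∏ l, (Nat.factorial ((k - Pi.single i 1 : Fin m → ℕ) l) : ℝ) =
      ∏ l, (Nat.factorial (k l) : ℝ) := by
  rw [← mul_prod_erase _ _ (mem_univ i),
    ← mul_prod_erase univ (fun l => (Nat.factorial (k l) : ℝ)) (mem_univ i),
    prod_congr rfl (g := fun l => (Nat.factorial (k l) : ℝ))
      (fun l hl => by simp [ne_of_mem_erase hl])]
  obtain ⟨a, ha⟩ := Nat.exists_eq_succ_of_ne_zero h
  simp [ha, Nat.factorial_succ]
  ring

lemma mchooseSub_eq (x : ℝ) (k : Fin m → ℕ) (i : Fin m) :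
    mchooseSub x k i =
      (∏ j ∈ range (∑ l, k l - 1), (x - (j : ℝ))) * k i / ∏ l, (Nat.factorial (k l) : ℝ) := by
  unfold mchooseSub
  split_ifs with h
  · simp [h]
  · have hk : (k i : ℝ) ≠ 0 := by exact_mod_cast h
    have hf : ∏ l, (Nat.factorial ((k - Pi.single i 1 : Fin m → ℕ) l) : ℝ) ≠ 0 :=
      prod_ne_zero_iff.2 fun l _ => by exact_mod_cast Nat.factorial_ne_zero _
    rw [mchoose, ← prod_factorial_sub_single h, ← sum_sub_single_add_one h, Nat.add_sub_cancel]
    field_simp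

/-- Pascal's rule for multinomial coefficients. -/
lemma mchoose_add_one (x : ℝ) (k : Fin m → ℕ) :
    mchoose (x + 1) k = mchoose x k + ∑ i, mchooseSub x k i := by
  simp only [mchooseSub_eq, ← sum_div, ← mul_sum, ← Nat.cast_sum]
  unfold mchoose
  rw [← add_div]
  congr 1
  generalize ∑ i, k i = N
  cases N with
  | zero => simp
  | succ N =>
    rw [prod_range_succ', prod_range_succ]
    simp only [Nat.add_sub_cancel]
    push_cast
    simp only [add_sub_add_right_eq_sub]
    ring

lemma mchoose_zero_of_ne_zero {k : Fin m → ℕ} (hk : k ≠ 0) : mchoose 0 k = 0 := by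
  have : ∑ i, k i ≠ 0 := by
    simpa [sum_eq_zero_iff, funext_iff] using hk
  rw [mchoose, prod_eq_zero (mem_range.2 (Nat.pos_of_ne_zero this)) (by simp), zero_div]

lemma mchoose_zero_right (x : ℝ) : mchoose x (0 : Fin m → ℕ) = 1 := by
  simp [mchoose]

/-- The multinomial coefficient `C(x, k)`, set to `0` for negative `x`. -/
noncomputable def truncChoose (x : ℤ) (k : Fin m → ℕ) : ℝ :=
  if x < 0 then 0 else mchoose (x : ℝ) k

/-- The truncated multinomial coefficient `C(x, k - eᵢ)`, equal to `0` when `kᵢ = 0`. -/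
noncomputable def truncChooseSub (x : ℤ) (k : Fin m → ℕ) (i : Fin m) : ℝ :=
  if k i = 0 then 0 else truncChoose x (k - Pi.single i 1)

lemma truncChoose_of_neg {x : ℤ} (hx : x < 0) (k : Fin m → ℕ) : truncChoose x k = 0 :=
  if_pos hx

lemma truncChoose_of_nonneg {x : ℤ} (hx : 0 ≤ x) (k : Fin m → ℕ) :
    truncChoose x k = mchoose (x : ℝ) k :=
  if_neg hx.not_gt

lemma truncChooseSub_of_neg {x : ℤ} (hx : x < 0) (k : Fin m → ℕ) (i : Fin m) :
    truncChooseSub x k i = 0 := by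
  simp [truncChooseSub, truncChoose_of_neg hx]

lemma truncChooseSub_of_nonneg {x : ℤ} (hx : 0 ≤ x) (k : Fin m → ℕ) (i : Fin m) :
    truncChooseSub x k i = mchooseSub (x : ℝ) k i := by
  simp [truncChooseSub, mchooseSub, truncChoose_of_nonneg hx]

lemma truncChoose_add_one {x : ℤ} {k : Fin m → ℕ} (h : k = 0 → 0 ≤ x) :
    truncChoose (x + 1) k = truncChoose x k + ∑ i, truncChooseSub x k i := by
  rcases lt_or_ge x 0 with hx | hx
  · have hk : k ≠ 0 := fun hk => (h hk).not_gt hx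
    simp only [truncChooseSub_of_neg hx, truncChoose_of_neg hx, sum_const_zero, add_zero]
    rcases lt_or_ge (x + 1) 0 with hx' | hx'
    · exact truncChoose_of_neg hx' k
    · obtain rfl : x = -1 := by omega
      simp [truncChoose, mchoose_zero_of_ne_zero hk]
  · simp only [truncChooseSub_of_nonneg hx, truncChoose_of_nonneg hx,
      truncChoose_of_nonneg (by omega : 0 ≤ x + 1)]
    push_cast
    exact mchoose_add_one _ _

lemma sum_Iic_shift_single (n : Fin m → ℕ) (i : Fin m) (f : (Fin m → ℕ) → (Fin m → ℕ) → ℝ) :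
    ∑ k ∈ Iic n, (if k i = 0 then 0 else f (k - Pi.single i 1) (n - k)) =
      ∑ k ∈ Iic n, (if (n - k) i = 0 then 0 else f k (n - k - Pi.single i 1)) := by
  simp only [← ite_not (_ = 0), ← sum_filter]
  refine sum_bij' (fun k _ => k - Pi.single i 1) (fun k _ => k + Pi.single i 1) ?_ ?_ ?_ ?_ ?_
  · intro k hk
    simp only [mem_filter, mem_Iic, Pi.le_def] at hk ⊢
    refine ⟨fun l => (Nat.sub_le _ _).trans (hk.1 l), ?_⟩
    have := hk.1 i
    simp
    omega
  · intro k hk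
    simp only [mem_filter, mem_Iic, Pi.le_def] at hk ⊢
    refine ⟨fun l => ?_, by simp⟩
    by_cases hl : l = i
    · subst hl
      have := hk.2
      simp at this ⊢
      omega
    · simpa [hl] using hk.1 l
  · intro k hk
    simp only [mem_filter] at hk
    funext l
    by_cases hl : l = i
    · subst hl
      simp
      omega
    · simp [hl]
  · intro k _
    simp
  · intro k hk
    simp only [mem_filter, mem_Iic, Pi.le_def] at hk
    congr 1
    funext l
    by_cases hl : l = i
    · subst hl
      have := hk.1 l
      simp
      omega
    · simp [hl]

/-- The number of words with `nᵢ` letters `i`, sorted by the first prefix whose length plus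
weight reaches `p`. -/
noncomputable def passageSum (n z : Fin m → ℕ) (p : ℤ) (q : ℝ) : ℝ :=
  ∑ k ∈ Iic n,
    (truncChoose (p - mdot k z) k * mchoose (q + mdot k z) (n - k) +
      ∑ i, ∑ j ∈ range (z i),
        truncChooseSub (p - mdot k z + j) k i * mchoose (q + mdot k z - (j + 1)) (n - k))

lemma passageSum_succ (n z : Fin m → ℕ) {p : ℤ} (hp : 0 ≤ p) (q : ℝ) :
    passageSum n z (p + 1) q = passageSum n z p (q + 1) := by
  have key : ∀ i, ∑ k ∈ Iic n, truncChooseSub (p - mdot k z + z i) k i *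
        mchoose (q + mdot k z - z i) (n - k) =
      ∑ k ∈ Iic n, truncChoose (p - mdot k z) k * mchooseSub (q + mdot k z) (n - k) i := by
    intro i
    have := sum_Iic_shift_single n i fun a b =>
      truncChoose (p - mdot a z) a * mchoose (q + mdot a z) b
    convert this using 2 with k _ k _
    · rw [truncChooseSub]
      split_ifs with h
      · simp
      · rw [← mdot_sub_single_add z h]
        push_cast
        congr 2 <;> ring
    · rw [mchooseSub]
      split_ifs <;> simp
  have key' := sum_congr (rfl : (univ : Finset (Fin m)) = univ) fun i _ => key i
  rw [sum_comm, sum_comm (s := univ)] at key'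
  rw [← sub_eq_zero] at key' ⊢
  rw [← key', passageSum, passageSum, ← sum_sub_distrib, ← sum_sub_distrib]
  refine sum_congr rfl fun k _ => ?_
  have h1 : truncChoose (p + 1 - mdot k z) k =
      truncChoose (p - mdot k z) k + ∑ i, truncChooseSub (p - mdot k z) k i := by
    rw [← truncChoose_add_one (by rintro rfl; simpa [mdot] using hp)]
    congr 1
    ring
  have h2 : mchoose (q + 1 + mdot k z) (n - k) =
      mchoose (q + mdot k z) (n - k) + ∑ i, mchooseSub (q + mdot k z) (n - k) i := by
    rw [← mchoose_add_one]
    congr 1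
    ring
  have h3 : ∀ i, ∑ j ∈ range (z i), truncChooseSub (p + 1 - mdot k z + j) k i *
        mchoose (q + mdot k z - (j + 1)) (n - k) =
      ∑ j ∈ range (z i), truncChooseSub (p - mdot k z + j) k i *
        mchoose (q + 1 + mdot k z - (j + 1)) (n - k) +
      (truncChooseSub (p - mdot k z + z i) k i * mchoose (q + mdot k z - z i) (n - k) -
        truncChooseSub (p - mdot k z) k i * mchoose (q + mdot k z) (n - k)) := by
    intro i
    have t := sum_range_sub (fun j : ℕ => truncChooseSub (p - mdot k z + j) k i *
      mchoose (q + mdot k z - j) (n - k)) (z i)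
    simp only [Nat.cast_zero, add_zero, sub_zero] at t
    rw [← t, ← sum_add_distrib]
    refine sum_congr rfl fun j _ => ?_
    have a1 : p + 1 - (mdot k z : ℤ) + j = p - mdot k z + (j + 1 : ℕ) := by push_cast; ring
    have a2 : q + 1 + (mdot k z : ℝ) - (j + 1) = q + mdot k z - j := by ring
    rw [a1, a2]
    push_cast
    ring
  simp only [h3, h1, h2, sum_add_distrib, sum_sub_distrib, ← sum_mul, ← mul_sum]
  ring

lemma passageSum_zero (n z : Fin m → ℕ) (hz : ∀ i, 1 ≤ z i) (q : ℝ) :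
    passageSum n z 0 q = mchoose q n := by
  rw [passageSum, sum_eq_single 0]
  · simp [mdot, truncChooseSub, truncChoose, mchoose_zero_right]
  · intro k _ hk
    obtain ⟨i, hi⟩ := Function.ne_iff.1 hk
    have hle : ∀ i, k i * z i ≤ mdot k z := fun i =>
      single_le_sum (f := fun i => k i * z i) (fun _ _ => Nat.zero_le _) (mem_univ i)
    have hpos : 0 < mdot k z :=
      (Nat.mul_pos (Nat.pos_of_ne_zero hi) (hz i)).trans_le (hle i)
    rw [truncChoose_of_neg (by omega), zero_mul, zero_add]
    refine sum_eq_zero fun l _ => sum_eq_zero fun j hj => ?_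
    by_cases hl : k l = 0
    · simp [truncChooseSub, hl]
    · have := (Nat.le_mul_of_pos_left (z l) (Nat.pos_of_ne_zero hl)).trans (hle l)
      have := mem_range.1 hj
      rw [truncChooseSub_of_neg (by omega), zero_mul]
  · simp

lemma passageSum_eq (n z : Fin m → ℕ) (hz : ∀ i, 1 ≤ z i) (p : ℕ) (q : ℝ) :
    passageSum n z p q = mchoose (p + q) n := by
  induction p generalizing q with
  | zero => simpa using passageSum_zero n z hz q
  | succ p ih =>
    push_cast
    rw [passageSum_succ n z (by omega), ih]
    congr 1
    ring

end KeyIdentity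


/-- **Equation (3.1)**: for `zᵢ ≥ 1` for all `i`, `p ≥ n·z` and `q ≥ 1`,
`∑_{k=0}^{n} ( C(p − k·z, k) · C(q + k·z, n − k)
  + ∑_{i=1}^{m} ∑_{j=1}^{zᵢ} C(p − k·z + j − 1, k − eᵢ) · C(q + k·z − j, n − k) )
  = C(p + q, n)`. -/
theorem key_identity (m : ℕ) (hm : 0 < m) (n z : Fin m → ℕ) (hz : ∀ i, 1 ≤ z i)
    (p q : ℕ) (hp : mdot n z ≤ p) (hq : 1 ≤ q) :
    ∑ k ∈ Finset.Iic n,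
        (mchoose ((p : ℝ) - (mdot k z : ℕ)) k * mchoose ((q : ℝ) + (mdot k z : ℕ)) (n - k) +
          ∑ i, ∑ j ∈ Finset.Icc 1 (z i),
            mchooseSub ((p : ℝ) - (mdot k z : ℕ) + (j : ℝ) - 1) k i *
              mchoose ((q : ℝ) + (mdot k z : ℕ) - (j : ℝ)) (n - k)) =
      mchoose ((p : ℝ) + (q : ℝ)) n := by
  rw [← passageSum_eq n z hz, passageSum]
  refine sum_congr rfl fun k hk => ?_
  have hkp : mdot k z ≤ p :=
    (sum_le_sum fun i _ => Nat.mul_le_mul_right _ (mem_Iic.1 hk i)).trans hp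
  rw [truncChoose_of_nonneg (by omega)]
  congr 1
  · push_cast
    rfl
  · refine sum_congr rfl fun i _ => ?_
    have hI : Finset.Icc 1 (z i) = Finset.Ico (0 + 1) (z i + 1) := by ext; simp
    rw [hI, ← sum_Ico_add', ← range_eq_Ico]
    refine sum_congr rfl fun j _ => ?_
    rw [truncChooseSub_of_nonneg (by omega)]
    push_cast
    congr 2
    ring
end
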